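/- arXiv:2412.20198 — 2 statements merged into one kernel-verified Lean document; each statement's English description precedes it below -/
import Mathlib

section
/- Let 2 ≤ k, let f₀ : (1,∞) → ℝ with s ↦ f₀(s)(s²-1)^{(k-3)/2} s integrable on (1,t). Then for ρ > 0 and x ∈ ℝⁿ with |x| = 1+ρ, the average over the unit sphere S^{k-1} of f₀(|x + ρθ|) equals (σ_{k-2}/σ_{k-1}) ∫_1^{1+2ρ} f₀(s) (s²-1)^{(k-3)/2} ((1+2ρ)² - s²)^{(k-3)/2} (2ρ(1+ρ))^{3-k} · s/(ρ(1+ρ)) ds. -/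
open MeasureTheory Set

open scoped ENNReal in
lemma aux_polar {E : Type*} [NormedAddCommGroup E] [NormedSpace ℝ E] [MeasurableSpace E]
    [BorelSpace E] [FiniteDimensional ℝ E] [Nontrivial E] (μ : Measure E) [μ.IsAddHaarMeasure]
    (f : E → ℝ≥0∞) (hf : Measurable f) :
    ∫⁻ y, f y ∂μ = ∫⁻ θ : Metric.sphere (0 : E) 1, ∫⁻ r in Ioi (0 : ℝ),
      ENNReal.ofReal (r ^ (Module.finrank ℝ E - 1)) * f (r • (θ : E)) ∂volume ∂μ.toSphere := by
  have h1 : ∫⁻ y, f y ∂μ = ∫⁻ y : ({(0 : E)}ᶜ : Set E), f y.1 ∂(μ.comap (↑)) := by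
    rw [lintegral_subtype_comap (measurableSet_singleton _).compl f, restrict_compl_singleton]
  have h2 := μ.measurePreserving_homeomorphUnitSphereProd.lintegral_comp_emb
    (Homeomorph.measurableEmbedding _)
    (fun p : Metric.sphere (0 : E) 1 × Ioi (0 : ℝ) => f ((p.2 : ℝ) • (p.1 : E)))
  have h3 : ∀ y : ({(0 : E)}ᶜ : Set E), f (((homeomorphUnitSphereProd E y).2 : ℝ) •
      ((homeomorphUnitSphereProd E y).1 : E)) = f y.1 := by
    intro y
    congr 1
    have hy : ‖(y : E)‖ ≠ 0 := norm_ne_zero_iff.2 y.2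
    simp [smul_smul, hy]
  simp only [h3] at h2
  rw [h1, h2, lintegral_prod _ (by fun_prop)]
  refine lintegral_congr fun θ => ?_
  rw [Measure.volumeIoiPow, lintegral_withDensity_eq_lintegral_mul _ (by fun_prop) (by fun_prop)]
  simp only [Pi.mul_apply]
  rw [lintegral_subtype_comap measurableSet_Ioi
    (fun r : ℝ => ENNReal.ofReal (r ^ (Module.finrank ℝ E - 1)) * f (r • (θ : E)))]

open scoped ENNReal in
lemma aux_area (m : ℕ) (hm : 1 ≤ m) :
    (volume : Measure (EuclideanSpace ℝ (Fin m))).toSphere univ =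
      ENNReal.ofReal (2 * Real.pi ^ ((m : ℝ) / 2) / Real.Gamma ((m : ℝ) / 2)) := by
  have : Nonempty (Fin m) := ⟨⟨0, hm⟩⟩
  have hm0 : (0 : ℝ) < m := by exact_mod_cast hm
  rw [Measure.toSphere_apply_univ, EuclideanSpace.volume_ball]
  simp only [finrank_euclideanSpace, Fintype.card_fin, ENNReal.ofReal_one, one_pow, one_mul]
  rw [← ENNReal.ofReal_natCast, ← ENNReal.ofReal_mul hm0.le, Real.Gamma_add_one (by positivity),
    Real.sqrt_eq_rpow, ← Real.rpow_natCast, ← Real.rpow_mul Real.pi_pos.le]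
  congr 1
  have hG := Real.Gamma_pos_of_pos (show 0 < (m : ℝ) / 2 by positivity)
  have : (1 / 2 * (m : ℝ)) = m / 2 := by ring
  rw [this]
  field_simp

open scoped ENNReal in
lemma aux_norm (m : ℕ) (hm : 1 ≤ m) (h : ℝ → ℝ≥0∞) (hh : Measurable h) :
    ∫⁻ v : EuclideanSpace ℝ (Fin m), h ‖v‖ =
      ENNReal.ofReal (2 * Real.pi ^ ((m : ℝ) / 2) / Real.Gamma ((m : ℝ) / 2)) *
        ∫⁻ w in Ioi (0 : ℝ), ENNReal.ofReal (w ^ (m - 1)) * h w := by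
  have : Nonempty (Fin m) := ⟨⟨0, hm⟩⟩
  rw [aux_polar volume _ (by fun_prop), ← aux_area m hm, mul_comm, ← lintegral_const]
  refine lintegral_congr fun θ => ?_
  refine setLIntegral_congr_fun measurableSet_Ioi fun w hw => ?_
  have : ‖(θ : EuclideanSpace ℝ (Fin m))‖ = 1 := by simp
  simp [norm_smul, this, abs_of_pos (mem_Ioi.1 hw)]

open scoped ENNReal in
lemma aux_split (m : ℕ) (F : ℝ → ℝ → ℝ≥0∞) (hF : Measurable (Function.uncurry F)) :
    ∫⁻ y : EuclideanSpace ℝ (Fin (m + 1)), F (y 0) ‖y‖ =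
      ∫⁻ u : ℝ, ∫⁻ v : EuclideanSpace ℝ (Fin m), F u (√(u ^ 2 + ‖v‖ ^ 2)) := by
  have hF' : ∀ {α : Type} [MeasurableSpace α] {a b : α → ℝ}, Measurable a → Measurable b →
      Measurable (fun x => F (a x) (b x)) := fun ha hb => hF.comp (ha.prodMk hb)
  rw [← (PiLp.volume_preserving_toLp (Fin (m+1))).lintegral_comp
    (hF' (by fun_prop) (by fun_prop))]
  rw [← (volume_preserving_piFinSuccAbove (fun _ : Fin (m+1) => ℝ) 0).symm.lintegral_comp
    (hF' (by fun_prop) (by fun_prop))]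
  rw [Measure.volume_eq_prod, lintegral_prod _ (Measurable.aemeasurable
    (hF' (by fun_prop) (by fun_prop)))]
  refine lintegral_congr fun u => ?_
  rw [← (PiLp.volume_preserving_toLp (Fin m)).lintegral_comp
    (hF' (by fun_prop) (by fun_prop))]
  refine lintegral_congr fun v => ?_
  simp [EuclideanSpace.norm_eq, Fin.sum_univ_succ, Real.sq_sqrt, Finset.sum_nonneg, sq_nonneg]

open scoped ENNReal in
lemma aux_polar2 (m : ℕ) (hm : 1 ≤ m) (G h : ℝ → ℝ≥0∞) (hG : Measurable G) (hh : Measurable h) :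
    ∫⁻ u : ℝ, ∫⁻ w in Ioi (0 : ℝ), ENNReal.ofReal (w ^ (m - 1)) *
        (G (u / √(u ^ 2 + w ^ 2)) * h (√(u ^ 2 + w ^ 2))) =
      (∫⁻ r in Ioi (0 : ℝ), ENNReal.ofReal (r ^ m) * h r) *
       ∫⁻ φ in Ioo 0 Real.pi, ENNReal.ofReal (Real.sin φ ^ (m - 1)) * G (Real.cos φ) := by
  set f : ℝ × ℝ → ℝ≥0∞ := fun p => (Ioi (0 : ℝ)).indicator (fun w =>
    ENNReal.ofReal (w ^ (m - 1)) *
        (G (p.1 / √(p.1 ^ 2 + w ^ 2)) * h (√(p.1 ^ 2 + w ^ 2)))) p.2 with hfdef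
  have hfm : Measurable f := by
    have : f = (Prod.snd ⁻¹' (Ioi (0:ℝ))).indicator (fun p : ℝ × ℝ =>
      ENNReal.ofReal (p.2 ^ (m - 1)) *
        (G (p.1 / √(p.1 ^ 2 + p.2 ^ 2)) * h (√(p.1 ^ 2 + p.2 ^ 2)))) := by
      ext p; simp [hfdef, indicator]
    rw [this]
    exact Measurable.indicator (by fun_prop) (measurable_snd measurableSet_Ioi)
  have h1 : ∫⁻ u : ℝ, ∫⁻ w in Ioi (0 : ℝ), ENNReal.ofReal (w ^ (m - 1)) *
        (G (u / √(u ^ 2 + w ^ 2)) * h (√(u ^ 2 + w ^ 2))) = ∫⁻ p, f p := by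
    rw [Measure.volume_eq_prod, lintegral_prod _ hfm.aemeasurable]
    refine lintegral_congr fun u => ?_
    rw [← lintegral_indicator measurableSet_Ioi]
  rw [h1, ← lintegral_comp_polarCoord_symm]
  have htar : polarCoord.target = Ioi (0 : ℝ) ×ˢ Ioo (-Real.pi) Real.pi := rfl
  set A : ℝ → ℝ≥0∞ := fun r => ENNReal.ofReal (r ^ m) * h r
  set B : ℝ → ℝ≥0∞ := (Ioo 0 Real.pi).indicator
    (fun φ => ENNReal.ofReal (Real.sin φ ^ (m - 1)) * G (Real.cos φ))
  have hA : Measurable A := by fun_prop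
  have hB : Measurable B := Measurable.indicator (by fun_prop) measurableSet_Ioo
  have h2 : ∫⁻ p in polarCoord.target, ENNReal.ofReal p.1 • f (polarCoord.symm p) =
      ∫⁻ p in Ioi (0 : ℝ) ×ˢ Ioo (-Real.pi) Real.pi, A p.1 * B p.2 := by
    rw [htar]
    refine setLIntegral_congr_fun (measurableSet_Ioi.prod measurableSet_Ioo) ?_
    rintro ⟨r, φ⟩ ⟨hr, hφ⟩
    simp only [mem_Ioi, mem_Ioo] at hr hφ
    have hs : √((r * Real.cos φ) ^ 2 + (r * Real.sin φ) ^ 2) = r := by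
      rw [show (r * Real.cos φ) ^ 2 + (r * Real.sin φ) ^ 2 = r ^ 2 by
        nlinarith [Real.sin_sq_add_cos_sq φ]]
      exact Real.sqrt_sq hr.le
    by_cases hφ0 : 0 < φ
    · have hsin : 0 < Real.sin φ := Real.sin_pos_of_pos_of_lt_pi hφ0 hφ.2
      have hpos : 0 < r * Real.sin φ := mul_pos hr hsin
      have hmem : φ ∈ Ioo 0 Real.pi := ⟨hφ0, hφ.2⟩
      simp only [hfdef, polarCoord_symm_apply, indicator_of_mem (mem_Ioi.2 hpos), A, B,
        indicator_of_mem hmem, hs, smul_eq_mul]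
      rw [mul_div_cancel_left₀ _ hr.ne', mul_pow, ENNReal.ofReal_mul (by positivity)]
      obtain ⟨n, rfl⟩ : ∃ n, m = n + 1 := ⟨m - 1, by omega⟩
      rw [pow_succ r n, ENNReal.ofReal_mul (by positivity)]
      simp only [Nat.add_sub_cancel]
      ring
    · have hsin : Real.sin φ ≤ 0 := Real.sin_nonpos_of_nonpos_of_neg_pi_le (not_lt.1 hφ0) hφ.1.le
      have hpos : ¬ 0 < r * Real.sin φ := not_lt.2 (mul_nonpos_of_nonneg_of_nonpos hr.le hsin)
      have hmem : φ ∉ Ioo 0 Real.pi := fun h => hφ0 h.1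
      simp [hfdef, indicator_of_notMem (show r * Real.sin φ ∉ Ioi 0 from hpos), B,
        indicator_of_notMem hmem]
  rw [h2, Measure.volume_eq_prod, ← Measure.prod_restrict,
    lintegral_prod_mul hA.aemeasurable hB.aemeasurable]
  congr 1
  simp only [B]
  rw [setLIntegral_indicator measurableSet_Ioo]
  congr 2
  rw [inter_eq_left.2]
  exact Ioo_subset_Ioo_left (by linarith [Real.pi_pos])

open scoped ENNReal in
lemma aux_slice (m : ℕ) (hm : 1 ≤ m) (G : ℝ → ℝ≥0∞) (hG : Measurable G)
    (e : EuclideanSpace ℝ (Fin (m + 1))) (he : ‖e‖ = 1) :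
    ∫⁻ θ : Metric.sphere (0 : EuclideanSpace ℝ (Fin (m + 1))) 1, G (inner ℝ e θ.1)
      ∂(volume : Measure (EuclideanSpace ℝ (Fin (m + 1)))).toSphere =
    ENNReal.ofReal (2 * Real.pi ^ ((m : ℝ) / 2) / Real.Gamma ((m : ℝ) / 2)) *
      ∫⁻ φ in Ioo 0 Real.pi, ENNReal.ofReal (Real.sin φ ^ (m - 1)) * G (Real.cos φ) := by
  obtain ⟨b, hb⟩ := Orthonormal.exists_orthonormalBasis_extension_of_card_eq (𝕜 := ℝ)
    (E := EuclideanSpace ℝ (Fin (m + 1))) (ι := Fin (m + 1)) (by simp)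
    (v := fun _ => e) (s := {0}) (by
      rw [orthonormal_iff_ite]
      rintro ⟨i, hi⟩ ⟨j, hj⟩
      simp only [mem_singleton_iff] at hi hj
      subst hi; subst hj
      simp [Set.domRestrict, he])
  have hb0 : b 0 = e := hb 0 rfl
  set h : ℝ → ℝ≥0∞ := (Ioo (0 : ℝ) 1).indicator 1 with hh
  have hhm : Measurable h := measurable_one.indicator measurableSet_Ioo
  set R := ∫⁻ r in Ioi (0 : ℝ), ENNReal.ofReal (r ^ m) * h r with hR
  have hRval : R = ENNReal.ofReal (1 / (m + 1)) := by
    have : R = ∫⁻ r in Ioc (0 : ℝ) 1, ENNReal.ofReal (r ^ m) := by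
      rw [hR, ← setLIntegral_congr (Ioo_ae_eq_Ioc (a := (0 : ℝ)) (b := 1))]
      have : ∀ r, ENNReal.ofReal (r ^ m) * h r =
        (Ioo (0 : ℝ) 1).indicator (fun r => ENNReal.ofReal (r ^ m)) r := by
        intro r
        by_cases hr : r ∈ Ioo (0 : ℝ) 1 <;> simp [hh, hr]
      simp only [this]
      rw [setLIntegral_indicator measurableSet_Ioo, inter_eq_left.2 Ioo_subset_Ioi_self]
    rw [this, ← ofReal_integral_eq_lintegral_ofReal, ← intervalIntegral.integral_of_le zero_le_one]
    · simp
    · exact (intervalIntegral.intervalIntegrable_pow m).1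
    · filter_upwards [ae_restrict_mem measurableSet_Ioc] with y hy
      exact pow_nonneg hy.1.le _
  have hR0 : R ≠ 0 := by rw [hRval]; simp; positivity
  have hRt : R ≠ ∞ := by rw [hRval]; simp
  set I := ∫⁻ y : EuclideanSpace ℝ (Fin (m + 1)), G (inner ℝ e y / ‖y‖) * h ‖y‖ with hI
  have e1 : I = (∫⁻ θ : Metric.sphere (0 : EuclideanSpace ℝ (Fin (m + 1))) 1, G (inner ℝ e θ.1)
      ∂(volume : Measure (EuclideanSpace ℝ (Fin (m + 1)))).toSphere) * R := by
    rw [hI, aux_polar volume _ (by fun_prop), ← lintegral_mul_const _ (by fun_prop)]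
    refine lintegral_congr fun θ => ?_
    rw [hR, ← lintegral_const_mul _ (by fun_prop)]
    refine setLIntegral_congr_fun measurableSet_Ioi fun r hr => ?_
    have hr : 0 < r := hr
    have : ‖(θ : EuclideanSpace ℝ (Fin (m + 1)))‖ = 1 := by simp
    simp only [norm_smul, this, Real.norm_eq_abs, abs_of_pos hr, inner_smul_right, mul_one,
      finrank_euclideanSpace, Fintype.card_fin, Nat.add_sub_cancel]
    rw [mul_div_cancel_left₀ _ hr.ne']
    ring
  have e2 : I = ∫⁻ y : EuclideanSpace ℝ (Fin (m + 1)), G (y 0 / ‖y‖) * h ‖y‖ := by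
    rw [hI, ← b.measurePreserving_repr.lintegral_comp
      (f := fun y : EuclideanSpace ℝ (Fin (m + 1)) => G (y 0 / ‖y‖) * h ‖y‖) (by fun_prop)]
    refine lintegral_congr fun y => ?_
    rw [b.repr_apply_apply, hb0, LinearIsometryEquiv.norm_map]
  have e3 : I = ENNReal.ofReal (2 * Real.pi ^ ((m : ℝ) / 2) / Real.Gamma ((m : ℝ) / 2)) *
      (R * ∫⁻ φ in Ioo 0 Real.pi, ENNReal.ofReal (Real.sin φ ^ (m - 1)) * G (Real.cos φ)) := by
    rw [e2, aux_split m (fun u n => G (u / n) * h n) (by unfold Function.uncurry; fun_prop),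
      hR, ← aux_polar2 m hm G h hG hhm, ← lintegral_const_mul' _ _ ENNReal.ofReal_ne_top]
    refine lintegral_congr fun u => ?_
    exact aux_norm m hm (fun w => G (u / √(u ^ 2 + w ^ 2)) * h (√(u ^ 2 + w ^ 2))) (by fun_prop)
  rw [← ENNReal.mul_left_inj hR0 hRt, ← e1, e3]
  ring

lemma aux_trig (k : ℕ) (hk : 2 ≤ k) (c S q : ℝ) (hc : 0 < c) (hS : 0 < S) (p : ℝ) (hp : 0 ≤ p)
    (hq : 0 ≤ q) (hpq : p * q = (c * S) ^ 2) :
    p ^ (((k : ℝ) - 3) / 2) * q ^ (((k : ℝ) - 3) / 2) * c ^ (3 - (k : ℝ)) * S = S ^ (k - 2) := by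
  rw [← Real.mul_rpow hp hq, hpq, ← Real.rpow_natCast (c * S) 2, ← Real.rpow_mul (by positivity),
    show ((2 : ℕ) : ℝ) * (((k : ℝ) - 3) / 2) = (k : ℝ) - 3 by push_cast; ring,
    Real.mul_rpow hc.le hS.le, show 3 - (k : ℝ) = -((k : ℝ) - 3) by ring, Real.rpow_neg hc.le]
  have h1 : 0 < c ^ ((k : ℝ) - 3) := Real.rpow_pos_of_pos hc _
  have h2 : S ^ ((k : ℝ) - 3) * S = S ^ (k - 2) := by
    rw [← Real.rpow_natCast, Nat.cast_sub hk, ← Real.rpow_add_one hS.ne']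
    congr 1
    push_cast
    ring
  rw [← h2]
  field_simp

open scoped ENNReal in
lemma aux_change (k : ℕ) (hk : 2 ≤ k) (ρ : ℝ) (hρ0 : 0 < ρ) (g : ℝ → ℝ≥0∞) :
    ∫⁻ s in Ioo 1 (1 + 2 * ρ), ENNReal.ofReal ((s ^ 2 - 1) ^ (((k : ℝ) - 3) / 2) *
          ((1 + 2 * ρ) ^ 2 - s ^ 2) ^ (((k : ℝ) - 3) / 2) *
          (2 * ρ * (1 + ρ)) ^ (3 - (k : ℝ)) * (s / (ρ * (1 + ρ)))) * g s =
    ∫⁻ φ in Ioo 0 Real.pi, ENNReal.ofReal (Real.sin φ ^ (k - 2)) *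
      g (√((1 + ρ) ^ 2 + ρ ^ 2 + 2 * ρ * (1 + ρ) * Real.cos φ)) := by
  set T : ℝ → ℝ := fun φ => √((1 + ρ) ^ 2 + ρ ^ 2 + 2 * ρ * (1 + ρ) * Real.cos φ) with hT
  set c := 2 * ρ * (1 + ρ) with hc
  have hcpos : 0 < c := by positivity
  have hcos : ∀ φ ∈ Ioo 0 Real.pi, -1 < Real.cos φ ∧ Real.cos φ < 1 := by
    intro φ hφ
    have hs := Real.sin_pos_of_pos_of_lt_pi hφ.1 hφ.2
    constructor <;> nlinarith [Real.sin_sq_add_cos_sq φ, Real.neg_one_le_cos φ, Real.cos_le_one φ]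
  have hin : ∀ φ ∈ Ioo 0 Real.pi, 1 < (1 + ρ) ^ 2 + ρ ^ 2 + c * Real.cos φ := by
    intro φ hφ
    have := mul_lt_mul_of_pos_left (hcos φ hφ).1 hcpos
    nlinarith
  have hTsq : ∀ φ ∈ Ioo 0 Real.pi, T φ ^ 2 = (1 + ρ) ^ 2 + ρ ^ 2 + c * Real.cos φ := by
    intro φ hφ
    exact Real.sq_sqrt (by linarith [hin φ hφ])
  have hT1 : ∀ φ ∈ Ioo 0 Real.pi, 1 < T φ := by
    intro φ hφ
    rw [hT]
    exact Real.lt_sqrt_of_sq_lt (by simpa using hin φ hφ)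
  have hT2 : ∀ φ ∈ Ioo 0 Real.pi, T φ < 1 + 2 * ρ := by
    intro φ hφ
    have := mul_lt_mul_of_pos_left (hcos φ hφ).2 hcpos
    have h2 := hTsq φ hφ
    have h1 := hT1 φ hφ
    nlinarith
  have himg : T '' Ioo 0 Real.pi = Ioo 1 (1 + 2 * ρ) := by
    apply Subset.antisymm
    · rintro _ ⟨φ, hφ, rfl⟩
      exact ⟨hT1 φ hφ, hT2 φ hφ⟩
    · rintro s ⟨hs1, hs2⟩
      set t := (s ^ 2 - (1 + ρ) ^ 2 - ρ ^ 2) / c with ht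
      have htc : c * t = s ^ 2 - (1 + ρ) ^ 2 - ρ ^ 2 := by rw [ht]; field_simp
      have ht1 : -1 < t := by rw [ht, lt_div_iff₀ hcpos]; nlinarith
      have ht2 : t < 1 := by rw [ht, div_lt_iff₀ hcpos]; nlinarith
      refine ⟨Real.arccos t, ⟨Real.arccos_pos.2 ht2, ?_⟩, ?_⟩
      · exact lt_of_le_of_ne (Real.arccos_le_pi t) (fun h => by
          rw [Real.arccos_eq_pi] at h; linarith)
      · simp only [hT]
        rw [Real.cos_arccos ht1.le ht2.le, htc]
        rw [show (1 + ρ) ^ 2 + ρ ^ 2 + (s ^ 2 - (1 + ρ) ^ 2 - ρ ^ 2) = s ^ 2 by ring]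
        exact Real.sqrt_sq (by linarith)
  have hinj : InjOn T (Ioo 0 Real.pi) := by
    intro a ha b hb hab
    have h1 := hTsq a ha
    rw [hab, hTsq b hb] at h1
    have h2 : Real.cos a = Real.cos b := by
      have : c * Real.cos a = c * Real.cos b := by linarith
      exact mul_left_cancel₀ hcpos.ne' this
    exact Real.injOn_cos (Ioo_subset_Icc_self ha) (Ioo_subset_Icc_self hb) h2
  have hder : ∀ φ ∈ Ioo 0 Real.pi, HasDerivWithinAt T (c * (-Real.sin φ) / (2 * T φ))
      (Ioo 0 Real.pi) φ := by
    intro φ hφ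
    refine HasDerivAt.hasDerivWithinAt ?_
    exact (((Real.hasDerivAt_cos φ).const_mul c).const_add _).sqrt (by linarith [hin φ hφ])
  rw [← himg, lintegral_image_eq_lintegral_abs_deriv_mul measurableSet_Ioo hder hinj]
  refine setLIntegral_congr_fun measurableSet_Ioo fun φ hφ => ?_
  have hs := Real.sin_pos_of_pos_of_lt_pi hφ.1 hφ.2
  have h1 := hT1 φ hφ
  have h2 := hT2 φ hφ
  have h3 := hTsq φ hφ
  have habs : |c * (-Real.sin φ) / (2 * T φ)| = c * Real.sin φ / (2 * T φ) := by
    rw [mul_neg, neg_div, abs_neg, abs_of_nonneg]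
    positivity
  rw [← mul_assoc, ← ENNReal.ofReal_mul (abs_nonneg _), habs]
  congr 2
  rw [← aux_trig k hk c (Real.sin φ) ((1 + 2 * ρ) ^ 2 - T φ ^ 2) hcpos hs (T φ ^ 2 - 1)
    (by nlinarith) (by nlinarith) (by
      rw [h3, mul_pow, Real.sin_sq, hc]; ring)]
  have hT0 : T φ ≠ 0 := by linarith
  have : c * Real.sin φ / (2 * T φ) * (T φ / (ρ * (1 + ρ))) = Real.sin φ := by
    rw [hc]; field_simp
  rw [mul_left_comm, this]

open scoped ENNReal in
lemma aux_main (k : ℕ) (hk : 2 ≤ k) (ρ : ℝ) (hρ0 : 0 < ρ)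
    (x : EuclideanSpace ℝ (Fin k)) (hx : ‖x‖ = 1 + ρ) (g : ℝ → ℝ≥0∞) (hg : Measurable g) :
    ∫⁻ θ : Metric.sphere (0 : EuclideanSpace ℝ (Fin k)) 1,
        g ‖x + ρ • (θ : EuclideanSpace ℝ (Fin k))‖
        ∂((volume : Measure (EuclideanSpace ℝ (Fin k))).toSphere) =
    ENNReal.ofReal (2 * Real.pi ^ (((k : ℝ) - 1) / 2) / Real.Gamma (((k : ℝ) - 1) / 2)) *
    ∫⁻ s in Ioo 1 (1 + 2 * ρ), ENNReal.ofReal ((s ^ 2 - 1) ^ (((k : ℝ) - 3) / 2) *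
          ((1 + 2 * ρ) ^ 2 - s ^ 2) ^ (((k : ℝ) - 3) / 2) *
          (2 * ρ * (1 + ρ)) ^ (3 - (k : ℝ)) * (s / (ρ * (1 + ρ)))) * g s := by
  rw [aux_change k hk ρ hρ0 g]
  obtain ⟨m, rfl⟩ : ∃ m, k = m + 1 := ⟨k - 1, by omega⟩
  have hρ1 : (0 : ℝ) < 1 + ρ := by linarith
  have := aux_slice m (by omega)
    (fun t => g (√((1 + ρ) ^ 2 + ρ ^ 2 + 2 * ρ * (1 + ρ) * t))) (by fun_prop)
    ((1 + ρ)⁻¹ • x) (by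
      rw [norm_smul, hx, norm_inv, Real.norm_eq_abs, abs_of_pos hρ1, inv_mul_cancel₀ hρ1.ne'])
  rw [show (((m + 1 : ℕ) : ℝ) - 1) = m by push_cast; ring, show m + 1 - 2 = m - 1 by omega, ← this]
  refine lintegral_congr fun θ => ?_
  congr 1
  have hθ : ‖(θ : EuclideanSpace ℝ (Fin (m + 1)))‖ = 1 := by simp
  symm
  rw [← Real.sqrt_sq (norm_nonneg (x + ρ • (θ : EuclideanSpace ℝ (Fin (m + 1)))))]
  congr 1
  rw [norm_add_sq_real, norm_smul, hθ, hx, inner_smul_right, real_inner_smul_left,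
    Real.norm_eq_abs, mul_one, sq_abs]
  field_simp
  ring

/-- Exterior tangent spherical mean of a radial function as a one-dimensional
Abel-type integral (Lemma 3.10). -/
theorem exterior_tangent_spherical_mean (k : ℕ) (hk : 2 ≤ k) (ρ : ℝ) (hρ0 : 0 < ρ)
    (f₀ : ℝ → ℝ)
    (hf : IntegrableOn (fun s => f₀ s * (s ^ 2 - 1) ^ (((k : ℝ) - 3) / 2) * s)
      (Set.Ioo 1 (1 + 2 * ρ)) volume)
    (x : EuclideanSpace ℝ (Fin k)) (hx : ‖x‖ = 1 + ρ) :
    (2 * Real.pi ^ ((k : ℝ) / 2) / Real.Gamma ((k : ℝ) / 2))⁻¹ *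
      ∫ θ : Metric.sphere (0 : EuclideanSpace ℝ (Fin k)) 1,
        f₀ ‖x + ρ • (θ : EuclideanSpace ℝ (Fin k))‖
        ∂((volume : Measure (EuclideanSpace ℝ (Fin k))).toSphere) =
    ((2 * Real.pi ^ (((k : ℝ) - 1) / 2) / Real.Gamma (((k : ℝ) - 1) / 2)) /
        (2 * Real.pi ^ ((k : ℝ) / 2) / Real.Gamma ((k : ℝ) / 2))) *
      ∫ s in (1:ℝ)..(1 + 2 * ρ),
        f₀ s * (s ^ 2 - 1) ^ (((k : ℝ) - 3) / 2) *
          ((1 + 2 * ρ) ^ 2 - s ^ 2) ^ (((k : ℝ) - 3) / 2) *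
          (2 * ρ * (1 + ρ)) ^ (3 - (k : ℝ)) * (s / (ρ * (1 + ρ))) := by
  have hk1 : (0 : ℝ) < (k : ℝ) - 1 := by
    have : (2 : ℝ) ≤ k := by exact_mod_cast hk
    linarith
  set C := 2 * Real.pi ^ (((k : ℝ) - 1) / 2) / Real.Gamma (((k : ℝ) - 1) / 2) with hC
  have hC0 : 0 ≤ C := by
    have := Real.Gamma_pos_of_pos (show 0 < ((k : ℝ) - 1) / 2 by positivity)
    positivity
  set W : ℝ → ℝ := fun s => (s ^ 2 - 1) ^ (((k : ℝ) - 3) / 2) *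
          ((1 + 2 * ρ) ^ 2 - s ^ 2) ^ (((k : ℝ) - 3) / 2) *
          (2 * ρ * (1 + ρ)) ^ (3 - (k : ℝ)) * (s / (ρ * (1 + ρ))) with hW
  have hWm : Measurable W := by fun_prop
  have hSm : Measurable (fun θ : Metric.sphere (0 : EuclideanSpace ℝ (Fin k)) 1 =>
      ‖x + ρ • (θ : EuclideanSpace ℝ (Fin k))‖) := by fun_prop
  have hmap : Measure.map (fun θ : Metric.sphere (0 : EuclideanSpace ℝ (Fin k)) 1 =>
      ‖x + ρ • (θ : EuclideanSpace ℝ (Fin k))‖)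
      ((volume : Measure (EuclideanSpace ℝ (Fin k))).toSphere) =
      ENNReal.ofReal C • (volume.restrict (Ioo 1 (1 + 2 * ρ))).withDensity
        (fun s => ENNReal.ofReal (W s)) := by
    refine Measure.ext_of_lintegral _ fun g hg => ?_
    rw [lintegral_map hg hSm, aux_main k hk ρ hρ0 x hx g hg, lintegral_smul_measure,
      lintegral_withDensity_eq_lintegral_mul _ (by fun_prop) hg]
    rfl
  have hfm : AEStronglyMeasurable f₀ (volume.restrict (Ioo 1 (1 + 2 * ρ))) := by
    have h1 : AEStronglyMeasurable (fun s => (f₀ s * (s ^ 2 - 1) ^ (((k : ℝ) - 3) / 2) * s) *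
        ((s ^ 2 - 1) ^ (((k : ℝ) - 3) / 2) * s)⁻¹) (volume.restrict (Ioo 1 (1 + 2 * ρ))) :=
      hf.aestronglyMeasurable.mul (Measurable.aestronglyMeasurable (by fun_prop))
    refine h1.congr ?_
    filter_upwards [ae_restrict_mem measurableSet_Ioo] with s hs
    have hs1 : 1 < s := hs.1
    have h2 : 0 < (s ^ 2 - 1) ^ (((k : ℝ) - 3) / 2) := Real.rpow_pos_of_pos (by nlinarith) _
    have h3 : s ≠ 0 := by linarith
    field_simp
  have hint : ∫ θ : Metric.sphere (0 : EuclideanSpace ℝ (Fin k)) 1,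
        f₀ ‖x + ρ • (θ : EuclideanSpace ℝ (Fin k))‖
        ∂((volume : Measure (EuclideanSpace ℝ (Fin k))).toSphere) =
      C * ∫ s in Ioo 1 (1 + 2 * ρ), W s * f₀ s := by
    rw [← integral_map (f := f₀) hSm.aemeasurable, hmap, integral_smul_measure,
      integral_withDensity_eq_integral_toReal_smul (by fun_prop) (by simp),
      ENNReal.toReal_ofReal hC0, smul_eq_mul]
    · congr 1
      refine setIntegral_congr_fun measurableSet_Ioo fun s hs => ?_
      have hs1 : 1 < s := hs.1
      have hs2 : s < 1 + 2 * ρ := hs.2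
      have hW0 : 0 ≤ W s := by
        have h1 : 0 ≤ (s ^ 2 - 1) := by nlinarith
        have h2 : 0 ≤ ((1 + 2 * ρ) ^ 2 - s ^ 2) := by nlinarith
        simp only [hW]
        positivity
      simp only [ENNReal.toReal_ofReal hW0, smul_eq_mul]
    · rw [hmap]
      refine AEStronglyMeasurable.mono_ac ?_ hfm
      exact (Measure.smul_absolutelyContinuous).trans (withDensity_absolutelyContinuous _ _)
  rw [hint, intervalIntegral.integral_of_le (by linarith), integral_Ioc_eq_integral_Ioo,
    div_eq_inv_mul C, mul_assoc (2 * Real.pi ^ ((k : ℝ) / 2) / Real.Gamma ((k : ℝ) / 2))⁻¹ C]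
  congr 2
  refine setIntegral_congr_fun measurableSet_Ioo fun s _ => ?_
  simp only [hW]
  ring
end

section
/- Let 1 ≤ k ≤ n-1 and let f₀ : (0,∞) → ℝ with s ↦ f₀(s) s^{(k-2)/2} locally integrable on [0,∞). For x ∈ ℝⁿ with xₙ > 0, the normalized spherical mean (1/σ_k) ∫_{S^k} f₀(xₙ(1+θₙ)) dθ over the k-sphere of radius xₙ tangent to the hyperplane {xₙ = 0} equals (Γ((k+1)/2)/π^{1/2}) xₙ^{1-k} · (1/Γ(k/2)) ∫_0^{2xₙ} (2xₙ - s)^{(k-2)/2} f₀(s) s^{(k-2)/2} ds. -/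
open MeasureTheory Set
open scoped ENNReal

lemma aux_radial {E : Type*} [NormedAddCommGroup E] [NormedSpace ℝ E] [MeasurableSpace E]
    [Nontrivial E] (μ : Measure E) [FiniteDimensional ℝ E] [BorelSpace E] [μ.IsAddHaarMeasure]
    (F : ℝ → ℝ≥0∞) (hF : Measurable F) :
    ∫⁻ x, F ‖x‖ ∂μ = μ.toSphere univ *
      ∫⁻ y in Ioi (0:ℝ), ENNReal.ofReal (y ^ (Module.finrank ℝ E - 1)) * F y := by
  have h1 : ∫⁻ x, F ‖x‖ ∂μ = ∫⁻ x : ({(0)}ᶜ : Set E), F ‖x.1‖ ∂(μ.comap (↑)) := by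
    rw [lintegral_subtype_comap (measurableSet_singleton _).compl fun x ↦ F (‖x‖),
      restrict_compl_singleton]
  have h2 := μ.measurePreserving_homeomorphUnitSphereProd.lintegral_comp_emb
    (Homeomorph.measurableEmbedding _) (fun p => F p.2.1)
  rw [h1]
  simp only [homeomorphUnitSphereProd_apply_snd_coe] at h2
  rw [h2, lintegral_prod _ (by fun_prop)]
  simp only [lintegral_const]
  rw [mul_comm]
  congr 1
  rw [Measure.volumeIoiPow, lintegral_withDensity_eq_lintegral_mul _ (by fun_prop) (by fun_prop)]
  simp only [Pi.mul_apply]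
  rw [lintegral_subtype_comap measurableSet_Ioi
    (fun y : ℝ => ENNReal.ofReal (y ^ (Module.finrank ℝ E - 1)) * F y)]

lemma aux_split_s17 (k : ℕ) (G : ℝ → ℝ → ℝ≥0∞) (hG : Measurable (Function.uncurry G)) :
    ∫⁻ x : EuclideanSpace ℝ (Fin (k+1)), G (x ⟨k, Nat.lt_succ_self k⟩) ‖x‖ =
    ∫⁻ t : ℝ, ∫⁻ y : EuclideanSpace ℝ (Fin k), G t (√(t^2 + ‖y‖^2)) := by
  rw [← (PiLp.volume_preserving_toLp (Fin (k+1))).lintegral_comp_emb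
    (MeasurableEquiv.toLp 2 _).measurableEmbedding]
  rw [← (volume_preserving_piFinSuccAbove (fun _ : Fin (k + 1) => ℝ) (Fin.last k)).symm.lintegral_comp_emb (MeasurableEquiv.measurableEmbedding _)]
  have : ∀ p : ℝ × (Fin k → ℝ), G ((WithLp.toLp 2 ((MeasurableEquiv.piFinSuccAbove (fun _ => ℝ) (Fin.last k)).symm p) : EuclideanSpace ℝ (Fin (k+1))) ⟨k, Nat.lt_succ_self k⟩)
     ‖(WithLp.toLp 2 ((MeasurableEquiv.piFinSuccAbove (fun _ => ℝ) (Fin.last k)).symm p) : EuclideanSpace ℝ (Fin (k+1)))‖ = G p.1 (√(p.1^2 + ∑ i, p.2 i ^ 2)) := by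
    intro p
    congr 1
    · rw [show (⟨k, Nat.lt_succ_self k⟩ : Fin (k+1)) = Fin.last k from rfl]
      simp [MeasurableEquiv.piFinSuccAbove]
    · rw [EuclideanSpace.norm_eq, Fin.sum_univ_castSucc, add_comm]
      simp [MeasurableEquiv.piFinSuccAbove]
  simp only [this]
  rw [show (volume : Measure (ℝ × (Fin k → ℝ))) = volume.prod volume from rfl, lintegral_prod]
  · refine lintegral_congr fun t => ?_
    rw [← (PiLp.volume_preserving_toLp (Fin k)).lintegral_comp_emb
      (MeasurableEquiv.toLp 2 _).measurableEmbedding]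
    refine lintegral_congr fun y => ?_
    simp [EuclideanSpace.norm_sq_eq]
  · apply Measurable.aemeasurable
    exact hG.comp (f := fun p : ℝ × (Fin k → ℝ) => (p.1, √(p.1^2 + ∑ i, p.2 i ^ 2))) (by fun_prop)

lemma aux_polar_s17 (m : ℕ) (G : ℝ → ℝ → ℝ≥0∞) (hG : Measurable (Function.uncurry G)) :
    ∫⁻ t : ℝ, ∫⁻ r in Ioi (0:ℝ), ENNReal.ofReal (r ^ m) * G t (√(t^2+r^2)) =
    ∫⁻ ρ in Ioi (0:ℝ), ∫⁻ θ in Ioo 0 Real.pi,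
      ENNReal.ofReal (ρ^(m+1) * Real.sin θ ^ m) * G (ρ * Real.cos θ) ρ := by
  have hGm : Measurable (fun p : ℝ × ℝ => G p.1 (√(p.1^2+p.2^2))) :=
    hG.comp (f := fun p : ℝ × ℝ => (p.1, √(p.1^2 + p.2 ^ 2))) (by fun_prop)
  have hGm2 : Measurable (fun p : ℝ × ℝ => G (p.1 * Real.cos p.2) p.1) :=
    hG.comp (f := fun p : ℝ × ℝ => (p.1 * Real.cos p.2, p.1)) (by fun_prop)
  have h1 : ∫⁻ t : ℝ, ∫⁻ r in Ioi (0:ℝ), ENNReal.ofReal (r ^ m) * G t (√(t^2+r^2)) =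
     ∫⁻ p : ℝ × ℝ, (univ ×ˢ Ioi (0:ℝ)).indicator (fun p => ENNReal.ofReal (p.2 ^ m) * G p.1 (√(p.1^2+p.2^2))) p := by
    rw [lintegral_indicator (by measurability), Measure.volume_eq_prod, ← Measure.prod_restrict,
      lintegral_prod _ (by fun_prop)]
    simp
  have h2 : ∫⁻ ρ in Ioi (0:ℝ), ∫⁻ θ in Ioo 0 Real.pi,
      ENNReal.ofReal (ρ^(m+1) * Real.sin θ ^ m) * G (ρ * Real.cos θ) ρ =
     ∫⁻ p in Ioi (0:ℝ) ×ˢ Ioo (-Real.pi) Real.pi, (Ioi (0:ℝ) ×ˢ Ioo 0 Real.pi).indicator (fun p =>  ENNReal.ofReal (p.1^(m+1) * Real.sin p.2 ^ m) * G (p.1 * Real.cos p.2) p.1) p := by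
    rw [lintegral_indicator (by measurability), Measure.restrict_restrict (by measurability)]
    have : Ioi (0:ℝ) ×ˢ Ioo 0 Real.pi ∩ Ioi (0:ℝ) ×ˢ Ioo (-Real.pi) Real.pi = Ioi (0:ℝ) ×ˢ Ioo 0 Real.pi := by
      apply inter_eq_left.2
      apply prod_mono subset_rfl
      apply Ioo_subset_Ioo_left
      linarith [Real.pi_pos]
    rw [this, Measure.volume_eq_prod, ← Measure.prod_restrict,
      lintegral_prod _ (by fun_prop)]
  rw [h1, h2, ← lintegral_comp_polarCoord_symm]
  rw [polarCoord_target]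
  refine setLIntegral_congr_fun (by measurability) fun p hp => ?_
  obtain ⟨h3, h4, h5⟩ := hp
  simp only [mem_Ioi] at h3
  simp only [polarCoord_symm_apply, smul_eq_mul]
  by_cases h : 0 < p.2
  · have hs := Real.sin_pos_of_pos_of_lt_pi h h5
    rw [indicator_of_mem (by simp; positivity), indicator_of_mem (by simp; tauto)]
    have : √((p.1 * Real.cos p.2)^2 + (p.1 * Real.sin p.2)^2) = p.1 := by
      rw [mul_pow, mul_pow, ← mul_add, Real.cos_sq_add_sin_sq, mul_one, Real.sqrt_sq h3.le]
    rw [this, ← mul_assoc, ← ENNReal.ofReal_mul h3.le]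
    congr 2
    ring
  · have hs := Real.sin_nonpos_of_nonpos_of_neg_pi_le (not_lt.1 h) h4.le
    rw [indicator_of_notMem, indicator_of_notMem, mul_zero]
    · simp [h]
    · simp only [mem_prod, mem_univ, true_and, mem_Ioi, not_lt]
      exact mul_nonpos_of_nonneg_of_nonpos h3.le hs

lemma aux_cos (m : ℕ) (g : ℝ → ℝ≥0∞) :
    ∫⁻ θ in Ioo 0 Real.pi, ENNReal.ofReal (Real.sin θ ^ m) * g (Real.cos θ) =
    ∫⁻ u in Ioo (-1:ℝ) 1, ENNReal.ofReal ((1-u^2) ^ (((m:ℝ) - 1)/2)) * g u := by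
  have him : Real.cos '' Ioo 0 Real.pi = Ioo (-1:ℝ) 1 := by
    ext u
    constructor
    · rintro ⟨θ, ⟨h1, h2⟩, rfl⟩
      constructor
      · have := Real.cos_lt_cos_of_nonneg_of_le_pi h1.le le_rfl h2
        simpa using this
      · have := Real.cos_lt_cos_of_nonneg_of_le_pi le_rfl h2.le h1
        simpa using this
    · rintro ⟨h1, h2⟩
      refine ⟨Real.arccos u, ⟨Real.arccos_pos.2 h2, ?_⟩, Real.cos_arccos h1.le h2.le⟩
      rcases (Real.arccos_le_pi u).lt_or_eq with h | h
      · exact h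
      · rw [Real.arccos_eq_pi] at h; linarith
  rw [← him, lintegral_image_eq_lintegral_abs_deriv_mul measurableSet_Ioo
    (fun x _ => (Real.hasDerivAt_cos x).hasDerivWithinAt)
    (Real.injOn_cos.mono Ioo_subset_Icc_self)]
  refine setLIntegral_congr_fun measurableSet_Ioo fun θ hθ => ?_
  have hs := Real.sin_pos_of_pos_of_lt_pi hθ.1 hθ.2
  rw [← mul_assoc, ← ENNReal.ofReal_mul (abs_nonneg _)]
  congr 2
  rw [abs_neg, abs_of_pos hs, ← Real.sin_sq, ← Real.rpow_natCast (Real.sin θ) 2, ← Real.rpow_mul hs.le]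
  rw [← Real.rpow_natCast]
  have h : ∀ a : ℝ, Real.sin θ * Real.sin θ ^ a = Real.sin θ ^ (1 + a) := fun a => by
    rw [Real.rpow_add hs, Real.rpow_one]
  rw [h]
  congr 1
  push_cast
  ring

lemma aux_rho (m : ℕ) : ∫⁻ ρ in Ioo (0:ℝ) 1, ENNReal.ofReal (ρ ^ (m+1)) =
    ENNReal.ofReal (1 / ((m:ℝ) + 2)) := by
  rw [Measure.restrict_congr_set Ioo_ae_eq_Ioc,
    ← ofReal_integral_eq_lintegral_ofReal (intervalIntegral.intervalIntegrable_pow _).1,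
    ← intervalIntegral.integral_of_le zero_le_one]
  · congr 1
    simp
    ring
  · filter_upwards [ae_restrict_mem measurableSet_Ioc] with y hy
    exact pow_nonneg hy.1.le _

open scoped Pointwise in
lemma aux_map (m : ℕ) :
    Measure.map (fun θ : Metric.sphere (0 : EuclideanSpace ℝ (Fin (m + 1 + 1))) 1 =>
      (θ : EuclideanSpace ℝ (Fin (m + 1 + 1))) ⟨m+1, Nat.lt_succ_self (m+1)⟩)
      (volume : Measure (EuclideanSpace ℝ (Fin (m + 1 + 1)))).toSphere =
    (volume : Measure (EuclideanSpace ℝ (Fin (m + 1)))).toSphere univ •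
      (volume.restrict (Ioo (-1:ℝ) 1)).withDensity
        (fun u => ENNReal.ofReal ((1-u^2) ^ (((m:ℝ) - 1)/2))) := by
  have hme : Measurable (fun θ : Metric.sphere (0 : EuclideanSpace ℝ (Fin (m + 1 + 1))) 1 =>
      (θ : EuclideanSpace ℝ (Fin (m + 1 + 1))) ⟨m+1, Nat.lt_succ_self (m+1)⟩) := by fun_prop
  ext A hA
  rw [Measure.map_apply hme hA, Measure.toSphere_apply' _ (hme hA)]
  set T : Set (ℝ × ℝ) := {p | 0 < p.2 ∧ p.2 < 1 ∧ p.1 / p.2 ∈ A} with hT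
  have hTm : MeasurableSet T := by
    apply MeasurableSet.inter
    · exact measurableSet_lt measurable_const measurable_snd
    apply MeasurableSet.inter
    · exact measurableSet_lt measurable_snd measurable_const
    · exact (show Measurable (fun p : ℝ × ℝ => p.1 / p.2) by fun_prop) hA
  set G : ℝ → ℝ → ℝ≥0∞ := fun t ρ => T.indicator 1 (t, ρ) with hG
  have hGm : Measurable (Function.uncurry G) := measurable_one.indicator hTm
  have hset : (Ioo (0:ℝ) 1 • (Subtype.val '' ((fun θ : Metric.sphere (0 : EuclideanSpace ℝ (Fin (m + 1 + 1))) 1 =>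
      (θ : EuclideanSpace ℝ (Fin (m + 1 + 1))) ⟨m+1, Nat.lt_succ_self (m+1)⟩) ⁻¹' A))) =
      {x : EuclideanSpace ℝ (Fin (m + 1 + 1)) | (x ⟨m+1, Nat.lt_succ_self (m+1)⟩, ‖x‖) ∈ T} := by
    ext x
    simp only [mem_smul, mem_image, mem_ofPred_eq, hT]
    constructor
    · rintro ⟨r, ⟨hr0, hr1⟩, _, ⟨θ, hθ, rfl⟩, rfl⟩
      have hn : ‖(θ : EuclideanSpace ℝ (Fin (m + 1 + 1)))‖ = 1 := by simp
      rw [norm_smul, hn, Real.norm_of_nonneg hr0.le, mul_one]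
      refine ⟨hr0, hr1, ?_⟩
      simpa [hr0.ne'] using hθ
    · rintro ⟨h0, h1, h2⟩
      refine ⟨‖x‖, ⟨h0, h1⟩, ‖x‖⁻¹ • x, ⟨⟨‖x‖⁻¹ • x, ?_⟩, ?_, rfl⟩, ?_⟩
      · simp [norm_smul, h0.ne']
      · simpa [div_eq_inv_mul] using h2
      · simp [smul_smul, h0.ne']
  have hvol : volume {x : EuclideanSpace ℝ (Fin (m + 1 + 1)) | (x ⟨m+1, Nat.lt_succ_self (m+1)⟩, ‖x‖) ∈ T} =
      ∫⁻ x : EuclideanSpace ℝ (Fin (m+1+1)), G (x ⟨m+1, Nat.lt_succ_self _⟩) ‖x‖ := by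
    rw [← lintegral_indicator_one]
    · rfl
    · exact (show Measurable (fun x : EuclideanSpace ℝ (Fin (m + 1 + 1)) => (x ⟨m+1, Nat.lt_succ_self (m+1)⟩, ‖x‖)) by fun_prop) hTm
  rw [hset, hvol, aux_split_s17 _ _ hGm]
  have hrad : ∀ t : ℝ, ∫⁻ y : EuclideanSpace ℝ (Fin (m+1)), G t (√(t^2 + ‖y‖^2)) =
      (volume : Measure (EuclideanSpace ℝ (Fin (m + 1)))).toSphere univ *
      ∫⁻ y in Ioi (0:ℝ), ENNReal.ofReal (y ^ m) * G t (√(t^2 + y^2)) := fun t => by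
    rw [aux_radial volume (fun r => G t (√(t^2+r^2)))]
    · simp
    · exact hGm.comp (f := fun r : ℝ => (t, √(t^2 + r^2))) (by fun_prop)
  simp only [hrad]
  rw [lintegral_const_mul' _ _ (measure_ne_top _ _), aux_polar_s17 m G hGm]
  have hin : ∀ ρ ∈ Ioi (0:ℝ), ∫⁻ θ in Ioo 0 Real.pi,
      ENNReal.ofReal (ρ^(m+1) * Real.sin θ ^ m) * G (ρ * Real.cos θ) ρ =
      (Ioo (0:ℝ) 1).indicator (fun ρ => ENNReal.ofReal (ρ^(m+1)) *
        ∫⁻ θ in Ioo 0 Real.pi, ENNReal.ofReal (Real.sin θ ^ m) * A.indicator 1 (Real.cos θ)) ρ := by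
    intro ρ hρ
    rw [mem_Ioi] at hρ
    by_cases h1 : ρ < 1
    · rw [indicator_of_mem (show ρ ∈ Ioo (0:ℝ) 1 from ⟨hρ, h1⟩), ← lintegral_const_mul' _ _ ENNReal.ofReal_ne_top]
      refine lintegral_congr fun θ => ?_
      rw [ENNReal.ofReal_mul (by positivity), mul_assoc]
      congr 2
      have hiff : (ρ * Real.cos θ, ρ) ∈ T ↔ Real.cos θ ∈ A := by
        rw [hT, mem_ofPred_eq]
        simp only [hρ, h1, true_and, mul_div_cancel_left₀ _ hρ.ne']
      by_cases hc : Real.cos θ ∈ A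
      · rw [indicator_of_mem hc]
        exact indicator_of_mem (hiff.2 hc) _
      · rw [indicator_of_notMem hc]
        exact indicator_of_notMem (fun h => hc (hiff.1 h)) _
    · rw [indicator_of_notMem (by simp [h1])]
      simp [hG, hT, indicator, h1]
  rw [setLIntegral_congr_fun measurableSet_Ioi hin, lintegral_indicator measurableSet_Ioo,
    Measure.restrict_restrict measurableSet_Ioo,
    inter_eq_left.2 Ioo_subset_Ioi_self, lintegral_mul_const _ (by fun_prop), aux_rho,
    aux_cos m (A.indicator 1)]
  rw [Measure.smul_apply, smul_eq_mul, withDensity_apply _ hA, ← lintegral_indicator hA]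
  have e : ∀ u : ℝ, ENNReal.ofReal ((1-u^2) ^ (((m:ℝ) - 1)/2)) * A.indicator 1 u =
      A.indicator (fun u => ENNReal.ofReal ((1-u^2) ^ (((m:ℝ) - 1)/2))) u := fun u => by
    by_cases h : u ∈ A <;> simp [h]
  simp only [e]
  have hc : ((Module.finrank ℝ (EuclideanSpace ℝ (Fin (m+1+1))) : ℕ) : ℝ≥0∞) * ENNReal.ofReal (1 / ((m:ℝ)+2)) = 1 := by
    rw [finrank_euclideanSpace_fin, ← ENNReal.ofReal_natCast, ← ENNReal.ofReal_mul (by positivity)]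
    rw [← ENNReal.ofReal_one]
    congr 1
    push_cast
    field_simp
    ring
  rw [mul_left_comm, ← mul_assoc (Nat.cast _), hc, one_mul]

lemma aux_const (m : ℕ) : ((volume : Measure (EuclideanSpace ℝ (Fin (m + 1)))).toSphere univ).toReal
    = 2 * √Real.pi ^ (m+1) / Real.Gamma (((m:ℝ)+1)/2) := by
  rw [Measure.toSphere_apply_univ, EuclideanSpace.volume_ball]
  have hg : Real.Gamma (((m:ℝ)+1)/2 + 1) = ((m:ℝ)+1)/2 * Real.Gamma (((m:ℝ)+1)/2) :=
    Real.Gamma_add_one (by positivity)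
  have hp : 0 < Real.Gamma (((m:ℝ)+1)/2) := Real.Gamma_pos_of_pos (by positivity)
  simp only [ENNReal.ofReal_one, one_pow, one_mul, Fintype.card_fin, ENNReal.toReal_mul,
    finrank_euclideanSpace_fin, ENNReal.toReal_natCast]
  push_cast
  rw [hg, ENNReal.toReal_ofReal (by positivity)]
  field_simp

theorem half_space_tangent_mean (n k : ℕ) (hk : 1 ≤ k) (hkn : k ≤ n - 1)
    (f₀ : ℝ → ℝ)
    (hf : ∀ a > (0:ℝ),
      IntegrableOn (fun s => f₀ s * s ^ (((k : ℝ) - 2) / 2)) (Set.Ioo 0 a) volume)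
    (xn : ℝ) (hxn : 0 < xn)
    (σk : ℝ) (hσk : σk = 2 * Real.pi ^ (((k : ℝ) + 1) / 2) / Real.Gamma (((k : ℝ) + 1) / 2)) :
    (1 / σk) *
      ∫ θ : Metric.sphere (0 : EuclideanSpace ℝ (Fin (k + 1))) 1,
        f₀ (xn * (1 + (θ : EuclideanSpace ℝ (Fin (k + 1))) ⟨k, Nat.lt_succ_self k⟩))
        ∂((volume : Measure (EuclideanSpace ℝ (Fin (k + 1)))).toSphere) =
    Real.Gamma (((k : ℝ) + 1) / 2) / Real.sqrt Real.pi * xn ^ (1 - (k : ℝ)) *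
      (1 / Real.Gamma ((k : ℝ) / 2)) *
      ∫ s in (0:ℝ)..(2 * xn),
        (2 * xn - s) ^ (((k : ℝ) - 2) / 2) * f₀ s * s ^ (((k : ℝ) - 2) / 2) := by
  obtain ⟨m, rfl⟩ : ∃ m, k = m + 1 := ⟨k - 1, by omega⟩
  set a : ℝ := (((m + 1 : ℕ) : ℝ) - 2) / 2 with ha
  have ham : ((m:ℝ) - 1) / 2 = a := by rw [ha]; push_cast; ring
  have him : (fun t : ℝ => xn * (1 + t)) '' Ioo (-1) 1 = Ioo 0 (2 * xn) := by
    ext s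
    constructor
    · rintro ⟨t, ⟨h1, h2⟩, rfl⟩
      constructor <;> simp only <;> nlinarith
    · rintro ⟨h1, h2⟩
      refine ⟨s / xn - 1, ⟨?_, ?_⟩, by field_simp; ring⟩
      · have := div_pos h1 hxn
        linarith
      · have : s / xn < 2 := (div_lt_iff₀ hxn).2 h2
        linarith
  have hder : ∀ t ∈ Ioo (-1:ℝ) 1,
      HasDerivWithinAt (fun t : ℝ => xn * (1 + t)) xn (Ioo (-1) 1) t := fun t _ => by
    have := (((hasDerivAt_id t).const_add 1).const_mul xn).hasDerivWithinAt (s := Ioo (-1) 1)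
    simpa using this
  have hinj : InjOn (fun t : ℝ => xn * (1 + t)) (Ioo (-1) 1) := fun t _ u _ h => by
    have := mul_left_cancel₀ hxn.ne' h
    linarith
  have hmeas : AEStronglyMeasurable (fun t => f₀ (xn * (1 + t))) (volume.restrict (Ioo (-1:ℝ) 1)) := by
    have h1 := hf (2 * xn) (by positivity)
    rw [← him, integrableOn_image_iff_integrableOn_abs_deriv_smul measurableSet_Ioo hder hinj] at h1
    have h2 := h1.aestronglyMeasurable
    have h3 : AEStronglyMeasurable (fun t : ℝ => (|xn| * (xn * (1 + t)) ^ a)⁻¹)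
        (volume.restrict (Ioo (-1:ℝ) 1)) := by
      apply Measurable.aestronglyMeasurable
      fun_prop
    refine (h2.mul h3).congr ?_
    filter_upwards [ae_restrict_mem measurableSet_Ioo] with t ht
    have h4 : 0 < xn * (1 + t) := mul_pos hxn (by linarith [ht.1])
    have h5 : 0 < (xn * (1 + t)) ^ a := Real.rpow_pos_of_pos h4 _
    have h6 : 0 < |xn| := abs_pos.2 hxn.ne'
    simp only [Pi.mul_apply, smul_eq_mul]
    field_simp
  have hL : ∫ θ : Metric.sphere (0 : EuclideanSpace ℝ (Fin (m + 1 + 1))) 1,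
        f₀ (xn * (1 + (θ : EuclideanSpace ℝ (Fin (m + 1 + 1))) ⟨m + 1, Nat.lt_succ_self (m + 1)⟩))
        ∂((volume : Measure (EuclideanSpace ℝ (Fin (m + 1 + 1)))).toSphere) =
      (2 * √Real.pi ^ (m+1) / Real.Gamma (((m:ℝ)+1)/2)) *
        ∫ t in Ioo (-1:ℝ) 1, (1 - t^2) ^ a * f₀ (xn * (1 + t)) := by
    have h1 := integral_map (μ := (volume : Measure (EuclideanSpace ℝ (Fin (m + 1 + 1)))).toSphere)
      (φ := fun θ : Metric.sphere (0 : EuclideanSpace ℝ (Fin (m + 1 + 1))) 1 =>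
      (θ : EuclideanSpace ℝ (Fin (m + 1 + 1))) ⟨m+1, Nat.lt_succ_self (m+1)⟩)
      (f := fun t => f₀ (xn * (1 + t))) (Measurable.aemeasurable (by fun_prop)) (by
        rw [aux_map]
        exact (hmeas.mono_ac (withDensity_absolutelyContinuous _ _)).smul_measure _)
    rw [← h1, aux_map, integral_smul_measure, aux_const, smul_eq_mul, ham,
      integral_withDensity_eq_integral_toReal_smul (by fun_prop) (by simp)]
    congr 1
    refine setIntegral_congr_fun measurableSet_Ioo fun t ht => ?_
    have : 0 ≤ 1 - t^2 := by nlinarith [ht.1, ht.2]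
    simp only [smul_eq_mul]
    rw [ENNReal.toReal_ofReal (Real.rpow_nonneg this _)]
  have hR : ∫ s in (0:ℝ)..(2 * xn), (2 * xn - s) ^ a * f₀ s * s ^ a =
      xn ^ ((m + 1 : ℕ) - 1 : ℝ) * ∫ t in Ioo (-1:ℝ) 1, (1 - t^2) ^ a * f₀ (xn * (1 + t)) := by
    rw [intervalIntegral.integral_of_le (by positivity), integral_Ioc_eq_integral_Ioo, ← him,
      integral_image_eq_integral_abs_deriv_smul measurableSet_Ioo hder hinj, ← integral_const_mul]
    refine setIntegral_congr_fun measurableSet_Ioo fun t ht => ?_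
    have h1 : 0 < 1 + t := by linarith [ht.1]
    have h2 : 0 < 1 - t := by linarith [ht.2]
    simp only [smul_eq_mul]
    rw [abs_of_pos hxn, show 2 * xn - xn * (1 + t) = xn * (1 - t) by ring,
      show 1 - t^2 = (1 - t) * (1 + t) by ring, Real.mul_rpow hxn.le h2.le,
      Real.mul_rpow hxn.le h1.le, Real.mul_rpow h2.le h1.le,
      show (((m + 1 : ℕ) : ℝ) - 1) = 1 + a + a by rw [ha]; ring, Real.rpow_add hxn,
      Real.rpow_add hxn, Real.rpow_one]
    ring
  rw [hL, hR, hσk]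
  have hx : xn ^ (1 - ((m + 1 : ℕ) : ℝ)) * xn ^ (((m + 1 : ℕ) : ℝ) - 1) = 1 := by
    rw [← Real.rpow_add hxn]; simp
  have hpi : Real.pi ^ ((((m + 1 : ℕ) : ℝ) + 1) / 2) = √Real.pi ^ (m + 1) * √Real.pi := by
    rw [← pow_succ, ← Real.rpow_natCast, Real.sqrt_eq_rpow, ← Real.rpow_mul Real.pi_pos.le]
    congr 1
    push_cast
    ring
  have hg : ((m:ℝ)+1)/2 = ((m + 1 : ℕ) : ℝ) / 2 := by push_cast; ring
  have hg1 : 0 < Real.Gamma (((m + 1 : ℕ) : ℝ) / 2) := Real.Gamma_pos_of_pos (by positivity)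
  have hg2 : 0 < Real.Gamma ((((m + 1 : ℕ) : ℝ) + 1) / 2) := Real.Gamma_pos_of_pos (by positivity)
  have hs : 0 < √Real.pi := Real.sqrt_pos.2 Real.pi_pos
  rw [hpi, hg]
  generalize ∫ t in Ioo (-1:ℝ) 1, (1 - t^2) ^ a * f₀ (xn * (1 + t)) = J
  generalize Real.Gamma (((m + 1 : ℕ) : ℝ) / 2) = g1 at *
  generalize Real.Gamma ((((m + 1 : ℕ) : ℝ) + 1) / 2) = g2 at *
  generalize xn ^ (1 - ((m + 1 : ℕ) : ℝ)) = X at *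
  generalize xn ^ (((m + 1 : ℕ) : ℝ) - 1) = Y at *
  have : g2 / √Real.pi * X * (1 / g1) * (Y * J) = g2 / √Real.pi * (1 / g1) * J * (X * Y) := by ring
  rw [this, hx]
  field_simp
end
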